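/- Let ε = {ε_Q}_{Q∈𝒟} be a collection of positive real numbers indexed by the dyadic cubes of ℝⁿ, bounded above and with the domination property, let 𝒮 ⊂ 𝒟 be a sparse collection, and let S_ε be the associated ε-sparse operator. If p is an exponent function with 1 < p_- ≤ p_+ < ∞ and p ∈ √εLH_0(ℝⁿ) ∩ LH_∞(ℝⁿ), where √ε = {√(ε_Q)}_{Q∈𝒟}, then there exists C such that ‖S_ε f‖_{p(·)} ≤ C‖f‖_{p(·)} for every nonnegative f ∈ L^{p(·)}(ℝⁿ). -/

import Mathlib

open MeasureTheory Set ENNReal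

noncomputable section

/-- The dyadic cube in `ℝⁿ` with side length `2^(-k)` and lower-left corner `2^(-k) • m`. -/
def dyadicCube (n : ℕ) (k : ℤ) (m : Fin n → ℤ) : Set (Fin n → ℝ) :=
  {x | ∀ i, (2 : ℝ) ^ (-k) * m i ≤ x i ∧ x i < (2 : ℝ) ^ (-k) * (m i + 1)}

/-- `Q` is a dyadic cube in `ℝⁿ`. -/
def IsDyadicCube (n : ℕ) (Q : Set (Fin n → ℝ)) : Prop :=
  ∃ (k : ℤ) (m : Fin n → ℤ), Q = dyadicCube n k m

/-- `η_𝒮(Q)`: the maximal elements of the collection `S` strictly contained in `Q`. -/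
def sparseMaximals {α : Type*} (S : Set (Set α)) (Q : Set α) : Set (Set α) :=
  {P | P ∈ S ∧ P ⊂ Q ∧ ∀ R ∈ S, R ⊂ Q → P ⊆ R → P = R}

/-- A collection `S` of sets is sparse if `Σ_{P ∈ η_S(Q)} |P| ≤ |Q|/2` for all `Q ∈ S`. -/
def IsSparse {α : Type*} [MeasureSpace α] (S : Set (Set α)) : Prop :=
  ∀ Q ∈ S, (∑' P : (sparseMaximals S Q), volume (P : Set α)) ≤ volume Q / 2

/-- The ε-sparse operator `S_ε f (x) = Σ_{Q ∈ S} ε_Q (⨍_Q f) χ_Q(x)`. -/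
def sparseOp {α : Type*} [MeasureSpace α] (ε : Set α → ℝ) (S : Set (Set α))
    (f : α → ℝ) (x : α) : ℝ :=
  ∑' Q : S, (Q : Set α).indicator
    (fun _ => ε Q * (((volume (Q : Set α)).toReal)⁻¹ * ∫ y in (Q : Set α), f y ∂volume)) x

/-- The variable Lebesgue norm `‖f‖_{p(·)}` (valued in `ℝ≥0∞`; it is `∞` iff
`f ∉ L^{p(·)}`). -/
def varLpNorm {α : Type*} [MeasurableSpace α] (p : α → ℝ) (μ : Measure α)
    (f : α → ℝ) : ℝ≥0∞ :=
  sInf {l : ℝ≥0∞ | ∃ r : ℝ, 0 < r ∧ l = ENNReal.ofReal r ∧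
    ∫⁻ x, ENNReal.ofReal ((|f x| / r) ^ p x) ∂μ ≤ 1}

/-- Membership in the variable Lebesgue space `L^{p(·)}`. -/
def MemVarLp {α : Type*} [MeasurableSpace α] (p : α → ℝ) (μ : Measure α)
    (f : α → ℝ) : Prop :=
  varLpNorm p μ f < ⊤

theorem lintegral_Ioi_indicator_rpow {s : ℝ} (hs : 0 < s) (b : ℝ) (hb : 0 ≤ b) :
    ∫⁻ t in Ioi (0 : ℝ), (Iio b).indicator (fun t => ENNReal.ofReal (t ^ (s - 1))) t
      = ENNReal.ofReal (b ^ s / s) := by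
  rw [lintegral_indicator measurableSet_Iio, Measure.restrict_restrict measurableSet_Iio,
    Iio_inter_Ioi, restrict_Ioo_eq_restrict_Ioc, ← ofReal_integral_eq_lintegral_ofReal]
  · rw [← intervalIntegral.integral_of_le hb, integral_rpow (Or.inl (by linarith))]
    simp [Real.zero_rpow hs.ne']
  · have := (intervalIntegral.intervalIntegrable_rpow' (a := 0) (b := b) (r := s - 1) (by linarith))
    rwa [intervalIntegrable_iff_integrableOn_Ioc_of_le hb] at this
  · filter_upwards [ae_restrict_mem measurableSet_Ioc] with t ht
    exact Real.rpow_nonneg ht.1.le _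

/-- The layer cake bound for a power on `[0, ∞]`, including the value `∞`. -/
theorem rpow_le_lintegral_Ioi {s : ℝ} (hs : 0 < s) (a : ℝ≥0∞) :
    a ^ s ≤ ENNReal.ofReal s *
      ∫⁻ t in Ioi (0 : ℝ), {t | ENNReal.ofReal t < a}.indicator
        (fun t => ENNReal.ofReal (t ^ (s - 1))) t := by
  have key : ∀ b : NNReal, (b : ℝ≥0∞) ≤ a → (b : ℝ≥0∞) ^ s ≤ ENNReal.ofReal s *
      ∫⁻ t in Ioi (0 : ℝ), {t | ENNReal.ofReal t < a}.indicator
        (fun t => ENNReal.ofReal (t ^ (s - 1))) t := by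
    intro b hb
    calc (b : ℝ≥0∞) ^ s = ENNReal.ofReal s * ENNReal.ofReal ((b : ℝ) ^ s / s) := by
          rw [← ENNReal.ofReal_mul hs.le, mul_div_cancel₀ _ hs.ne',
            ← ENNReal.ofReal_rpow_of_nonneg b.coe_nonneg hs.le, ENNReal.ofReal_coe_nnreal]
      _ ≤ _ := by
          rw [← lintegral_Ioi_indicator_rpow hs _ b.coe_nonneg]
          gcongr ENNReal.ofReal s * ?_
          refine setLIntegral_mono_ae' measurableSet_Ioi (.of_forall fun t (ht0 : 0 < t) => ?_)
          by_cases ht : t < b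
          swap; · simp [indicator, ht]
          rw [indicator_of_mem (show t ∈ Iio (b : ℝ) from ht), indicator_of_mem]
          change ENNReal.ofReal t < a
          refine lt_of_lt_of_le ?_ hb
          rw [← ENNReal.ofReal_coe_nnreal]
          exact (ENNReal.ofReal_lt_ofReal_iff_of_nonneg ht0.le).2 ht
  induction a with
  | coe b => exact key b le_rfl
  | top =>
    rw [ENNReal.top_rpow_of_pos hs, top_le_iff]
    refine ENNReal.eq_top_of_forall_nnreal_le fun r => ?_
    have := key (r ^ s⁻¹) le_top
    rwa [← ENNReal.coe_rpow_of_nonneg _ hs.le, ← NNReal.rpow_mul, inv_mul_cancel₀ hs.ne',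
      NNReal.rpow_one] at this

/-- The weak-type estimate for the averages over a finite laminar family. -/
theorem mul_measure_biUnion_le_lintegral {α : Type*} [MeasurableSpace α] {μ : Measure α}
    (T : Finset (Set α)) (hT : ∀ P ∈ T, ∀ Q ∈ T, P ⊆ Q ∨ Q ⊆ P ∨ Disjoint P Q)
    (hmeas : ∀ Q ∈ T, MeasurableSet Q) (u : α → ℝ≥0∞) (t : ℝ≥0∞)
    (ht : ∀ Q ∈ T, t * μ Q ≤ ∫⁻ x in Q, u x ∂μ) :
    t * μ (⋃ Q ∈ T, Q) ≤ ∫⁻ x, u x ∂μ := by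
  classical
  set M := T.filter (fun Q => Maximal (· ∈ T) Q) with hM
  have hMT : ∀ Q ∈ M, Q ∈ T := fun Q hQ => (Finset.mem_filter.1 hQ).1
  have hU : (⋃ Q ∈ T, Q) ⊆ ⋃ Q ∈ M, Q := by
    refine iUnion₂_subset fun Q hQ => ?_
    obtain ⟨R, hQR, hR⟩ := T.exists_le_maximal hQ
    exact hQR.trans (subset_biUnion_of_mem (u := id)
      (show R ∈ (M : Set (Set α)) from Finset.mem_coe.2 (Finset.mem_filter.2 ⟨hR.1, hR⟩)))
  have hdisj : (M : Set (Set α)).PairwiseDisjoint id := by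
    intro P hP Q hQ hPQ
    have hP' := Finset.mem_filter.1 (Finset.mem_coe.1 hP)
    have hQ' := Finset.mem_filter.1 (Finset.mem_coe.1 hQ)
    rcases hT P hP'.1 Q hQ'.1 with h | h | h
    · exact absurd (hP'.2.eq_of_subset hQ'.1 h) hPQ
    · exact absurd (hQ'.2.eq_of_subset hP'.1 h) hPQ.symm
    · exact h
  calc t * μ (⋃ Q ∈ T, Q) ≤ t * ∑ Q ∈ M, μ Q := by
        gcongr
        exact (measure_mono hU).trans (measure_biUnion_finset_le _ _)
    _ ≤ ∑ Q ∈ M, ∫⁻ x in Q, u x ∂μ := by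
        rw [Finset.mul_sum]
        exact Finset.sum_le_sum fun Q hQ => ht Q (hMT Q hQ)
    _ = ∫⁻ x in ⋃ Q ∈ M, Q, u x ∂μ :=
        (lintegral_biUnion_finset hdisj (fun Q hQ => hmeas Q (hMT Q hQ)) u).symm
    _ ≤ _ := setLIntegral_le_lintegral _ _

/-- Carleson embedding for a finite laminar family carrying pairwise disjoint subsets `E Q ⊆ Q`:
a dyadic maximal theorem in disguise. -/
theorem sum_laverage_rpow_mul_le {α : Type*} [MeasurableSpace α] {μ : Measure α} [SFinite μ]
    {s : ℝ} (hs : 1 < s)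
    (T : Finset (Set α)) (hT : ∀ P ∈ T, ∀ Q ∈ T, P ⊆ Q ∨ Q ⊆ P ∨ Disjoint P Q)
    (hmeas : ∀ Q ∈ T, MeasurableSet Q) (hfin : ∀ Q ∈ T, μ Q ≠ ∞)
    (E : Set α → Set α) (hE : ∀ Q ∈ T, E Q ⊆ Q) (hEmeas : ∀ Q ∈ T, MeasurableSet (E Q))
    (hEdisj : (T : Set (Set α)).PairwiseDisjoint E)
    (h : α → ℝ≥0∞) (hh : Measurable h) (hhtop : ∀ x, h x ≠ ∞) :
    ∑ Q ∈ T, (⨍⁻ x in Q, h x ∂μ) ^ s * μ (E Q) ≤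
      ENNReal.ofReal (2 ^ s * s / (s - 1)) * ∫⁻ x, h x ^ s ∂μ := by
  classical
  have hs0 : 0 < s := by linarith
  set u : ℝ → α → ℝ≥0∞ := fun t x => {x | ENNReal.ofReal t < 2 * h x}.indicator h x with hu
  have hlevel : ∀ t : ℝ, 0 < t →
      ∑ Q ∈ T with ENNReal.ofReal t < ⨍⁻ x in Q, h x ∂μ, μ (E Q) ≤
        ENNReal.ofReal (2 / t) * ∫⁻ x, u t x ∂μ := by
    intro t ht
    set Tt := T.filter (fun Q => ENNReal.ofReal t < ⨍⁻ x in Q, h x ∂μ) with hTt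
    have hsub : ∀ Q ∈ Tt, Q ∈ T := fun Q hQ => (Finset.mem_filter.1 hQ).1
    have hweak := mul_measure_biUnion_le_lintegral (μ := μ) Tt
      (fun P hP Q hQ => hT P (hsub P hP) Q (hsub Q hQ)) (fun Q hQ => hmeas Q (hsub Q hQ))
      (u t) (ENNReal.ofReal (t / 2)) (by
        intro Q hQ
        have hfQ := hfin Q (hsub Q hQ)
        have h1 : ENNReal.ofReal t * μ Q ≤ ∫⁻ x in Q, h x ∂μ := by
          have := (Finset.mem_filter.1 hQ).2.le
          rw [setLAverage_eq] at this
          exact (mul_le_mul_left this _).trans (ENNReal.mul_le_of_le_div le_rfl)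
        have h2 : ∫⁻ x in Q, h x ∂μ ≤ ∫⁻ x in Q, (u t x + ENNReal.ofReal (t / 2)) ∂μ := by
          refine lintegral_mono fun x => ?_
          by_cases hx : ENNReal.ofReal t < 2 * h x
          · simp [hu, indicator, hx]
          · refine le_add_left ?_
            rw [ENNReal.ofReal_div_of_pos (by norm_num), ENNReal.ofReal_ofNat,
              ENNReal.le_div_iff_mul_le (by simp) (by simp), mul_comm]
            exact not_lt.1 hx
        rw [lintegral_add_right _ measurable_const, setLIntegral_const] at h2
        have h3 : ENNReal.ofReal (t / 2) * μ Q + ENNReal.ofReal (t / 2) * μ Q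
            ≤ ∫⁻ x in Q, u t x ∂μ + ENNReal.ofReal (t / 2) * μ Q := by
          rw [← add_mul, ← ENNReal.ofReal_add (by positivity) (by positivity), add_halves]
          exact h1.trans h2
        exact (ENNReal.add_le_add_iff_right (ENNReal.mul_ne_top ENNReal.ofReal_ne_top hfQ)).1 h3)
    calc ∑ Q ∈ Tt, μ (E Q) = μ (⋃ Q ∈ Tt, E Q) :=
          (measure_biUnion_finset (hEdisj.subset (by exact_mod_cast hsub))
            fun Q hQ => hEmeas Q (hsub Q hQ)).symm
      _ ≤ μ (⋃ Q ∈ Tt, Q) := measure_mono (iUnion₂_mono fun Q hQ => hE Q (hsub Q hQ))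
      _ = ENNReal.ofReal (2 / t) * (ENNReal.ofReal (t / 2) * μ (⋃ Q ∈ Tt, Q)) := by
          rw [← mul_assoc, ← ENNReal.ofReal_mul (by positivity)]
          have : 2 / t * (t / 2) = 1 := by field_simp
          simp [this]
      _ ≤ _ := by gcongr
  have hum : Measurable (fun z : ℝ × α => u z.1 z.2) := by
    have : (fun z : ℝ × α => u z.1 z.2) =
        {z : ℝ × α | ENNReal.ofReal z.1 < 2 * h z.2}.indicator (fun z => h z.2) := by
      ext z; simp [hu, indicator]
    rw [this]
    exact (hh.comp measurable_snd).indicator (measurableSet_lt (by fun_prop) (by fun_prop))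
  have hind : ∀ a : ℝ≥0∞, MeasurableSet {t : ℝ | ENNReal.ofReal t < a} :=
    fun a => measurableSet_lt ENNReal.measurable_ofReal measurable_const
  calc ∑ Q ∈ T, (⨍⁻ x in Q, h x ∂μ) ^ s * μ (E Q)
      ≤ ∑ Q ∈ T, (ENNReal.ofReal s *
          ∫⁻ t in Ioi (0 : ℝ), {t | ENNReal.ofReal t < ⨍⁻ x in Q, h x ∂μ}.indicator
            (fun t => ENNReal.ofReal (t ^ (s - 1))) t) * μ (E Q) := by
        gcongr with Q hQ
        exact rpow_le_lintegral_Ioi hs0 _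
    _ = ENNReal.ofReal s * ∫⁻ t in Ioi (0 : ℝ), ∑ Q ∈ T,
          {t | ENNReal.ofReal t < ⨍⁻ x in Q, h x ∂μ}.indicator
            (fun t => ENNReal.ofReal (t ^ (s - 1))) t * μ (E Q) := by
        rw [lintegral_finsetSum, Finset.mul_sum]
        · refine Finset.sum_congr rfl fun Q _ => ?_
          rw [lintegral_mul_const, mul_assoc]
          exact Measurable.indicator (by fun_prop) (hind _)
        · intro Q _
          exact (Measurable.indicator (by fun_prop) (hind _)).mul_const _
    _ ≤ ENNReal.ofReal s *
          ∫⁻ t in Ioi (0 : ℝ), ∫⁻ x, ENNReal.ofReal (2 * t ^ (s - 2)) * u t x ∂μ := by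
        gcongr ENNReal.ofReal s * ?_
        refine setLIntegral_mono' measurableSet_Ioi fun t (ht : 0 < t) => ?_
        have hpow : t ^ (s - 1) * (2 / t) = 2 * t ^ (s - 2) := by
          rw [show s - 2 = s - 1 - 1 by ring, Real.rpow_sub_one ht.ne' (s - 1)]; ring
        rw [lintegral_const_mul' _ _ ENNReal.ofReal_ne_top, ← hpow,
          ENNReal.ofReal_mul (by positivity), mul_assoc]
        refine le_trans (le_of_eq ?_) (mul_le_mul_right (hlevel t ht) _)
        rw [Finset.sum_filter, Finset.mul_sum]
        refine Finset.sum_congr rfl fun Q _ => ?_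
        by_cases hQ : ENNReal.ofReal t < ⨍⁻ x in Q, h x ∂μ <;> simp [indicator, hQ]
    _ = ENNReal.ofReal s *
          ∫⁻ x, (∫⁻ t in Ioi (0 : ℝ), ENNReal.ofReal (2 * t ^ (s - 2)) * u t x) ∂μ := by
        rw [lintegral_lintegral_swap]
        exact (Measurable.mul (f := fun z : ℝ × α => ENNReal.ofReal (2 * z.1 ^ (s - 2)))
          (by fun_prop) hum).aemeasurable
    _ = ENNReal.ofReal s * ∫⁻ x, ENNReal.ofReal (2 ^ s / (s - 1)) * h x ^ s ∂μ := by
        congr 1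
        refine lintegral_congr fun x => ?_
        obtain ⟨b, hb⟩ : ∃ b : NNReal, h x = b := ⟨_, (ENNReal.coe_toNNReal (hhtop x)).symm⟩
        have h1 : ∀ t ∈ Ioi (0 : ℝ), ENNReal.ofReal (2 * t ^ (s - 2)) * u t x =
            (2 * h x) * (Iio (2 * b : ℝ)).indicator
              (fun t => ENNReal.ofReal (t ^ ((s - 1) - 1))) t := by
          intro t ht
          have hiff : ENNReal.ofReal t < 2 * (b : ℝ≥0∞) ↔ t < 2 * b := by
            rw [← ENNReal.ofReal_coe_nnreal, ← ENNReal.ofReal_ofNat 2,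
              ← ENNReal.ofReal_mul (by norm_num)]
            exact ENNReal.ofReal_lt_ofReal_iff_of_nonneg ht.le
          rw [ENNReal.ofReal_mul (by norm_num), ENNReal.ofReal_ofNat,
            show s - 1 - 1 = s - 2 by ring]
          simp only [hu, indicator, mem_ofPred_eq, hb, hiff, mem_Iio]
          split_ifs <;> ring
        rw [setLIntegral_congr_fun measurableSet_Ioi h1,
          lintegral_const_mul' _ _ (by simp [hb, ENNReal.mul_eq_top]),
          lintegral_Ioi_indicator_rpow (by linarith) _ (by positivity), hb,
          ← ENNReal.ofReal_coe_nnreal, ENNReal.ofReal_rpow_of_nonneg b.coe_nonneg hs0.le,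
          ← ENNReal.ofReal_ofNat 2, ← ENNReal.ofReal_mul (by norm_num),
          ← ENNReal.ofReal_mul (by positivity), ← ENNReal.ofReal_mul (by
            have : 0 < s - 1 := by linarith
            positivity)]
        congr 1
        rcases eq_or_lt_of_le b.coe_nonneg with h0 | h0
        · rw [← h0]; simp [Real.zero_rpow hs0.ne']
        · rw [← mul_div_assoc, div_mul_eq_mul_div, ← Real.mul_rpow (by norm_num) h0.le,
            Real.rpow_sub_one (by positivity)]
          congr 1
          field_simp
    _ = _ := by
        rw [lintegral_const_mul' _ _ ENNReal.ofReal_ne_top, ← mul_assoc,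
          ← ENNReal.ofReal_mul hs0.le]
        congr 2
        ring

section Dyadic

variable {n : ℕ}

theorem dyadicCube_eq_pi (k : ℤ) (m : Fin n → ℤ) :
    dyadicCube n k m = univ.pi fun i => Ico ((2 : ℝ) ^ (-k) * m i) ((2 : ℝ) ^ (-k) * (m i + 1)) := by
  ext x; simp [dyadicCube, mem_pi]

theorem IsDyadicCube.measurableSet {Q : Set (Fin n → ℝ)} (hQ : IsDyadicCube n Q) :
    MeasurableSet Q := by
  obtain ⟨k, m, rfl⟩ := hQ
  rw [dyadicCube_eq_pi]
  exact MeasurableSet.univ_pi fun i => measurableSet_Ico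

theorem volume_dyadicCube (k : ℤ) (m : Fin n → ℤ) :
    volume (dyadicCube n k m) = ENNReal.ofReal ((2 : ℝ) ^ (-k)) ^ n := by
  rw [dyadicCube_eq_pi, Real.volume_pi_Ico]
  simp [mul_add]

theorem IsDyadicCube.volume_ne_zero {Q : Set (Fin n → ℝ)} (hQ : IsDyadicCube n Q) :
    volume Q ≠ 0 := by
  obtain ⟨k, m, rfl⟩ := hQ
  rw [volume_dyadicCube]
  exact pow_ne_zero _ (ENNReal.ofReal_pos.2 (by positivity)).ne'

theorem IsDyadicCube.volume_ne_top {Q : Set (Fin n → ℝ)} (hQ : IsDyadicCube n Q) :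
    volume Q ≠ ∞ := by
  obtain ⟨k, m, rfl⟩ := hQ
  rw [volume_dyadicCube]
  exact ENNReal.pow_ne_top ENNReal.ofReal_ne_top

theorem IsDyadicCube.nonempty {Q : Set (Fin n → ℝ)} (hQ : IsDyadicCube n Q) : Q.Nonempty :=
  nonempty_of_measure_ne_zero hQ.volume_ne_zero

theorem dyadicCube_subset_of_le {k l : ℤ} (hkl : k ≤ l) {m m' : Fin n → ℤ} {x : Fin n → ℝ}
    (hx : x ∈ dyadicCube n k m) (hx' : x ∈ dyadicCube n l m') :
    dyadicCube n l m' ⊆ dyadicCube n k m := by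
  obtain ⟨j, rfl⟩ := Int.le.dest hkl
  intro y hy i
  have h1 := hx i
  have h2 := hx' i
  have h3 := hy i
  have hpos : (0 : ℝ) < 2 ^ (-(k + j : ℤ)) := by positivity
  have hk : (2 : ℝ) ^ (-k) = 2 ^ (-(k + j : ℤ)) * ((2 ^ j : ℤ) : ℝ) := by
    push_cast
    rw [← zpow_natCast, ← zpow_add₀ (by norm_num)]
    congr 1; ring
  rw [hk, mul_assoc, mul_assoc] at h1 ⊢
  have h4 : ((2 ^ j : ℤ) : ℝ) * m i < m' i + 1 :=
    lt_of_mul_lt_mul_left (h1.1.trans_lt h2.2) hpos.le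
  have h5 : (m' i : ℝ) < ((2 ^ j : ℤ) : ℝ) * (m i + 1) :=
    lt_of_mul_lt_mul_left (h2.1.trans_lt h1.2) hpos.le
  have h6 : (2 ^ j : ℤ) * m i ≤ m' i := by
    have : (2 ^ j : ℤ) * m i < m' i + 1 := by exact_mod_cast h4
    omega
  have h7 : m' i + 1 ≤ (2 ^ j : ℤ) * (m i + 1) := by
    have : m' i < (2 ^ j : ℤ) * (m i + 1) := by exact_mod_cast h5
    omega
  constructor
  · refine le_trans (mul_le_mul_of_nonneg_left ?_ hpos.le) h3.1
    exact_mod_cast h6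
  · refine lt_of_lt_of_le h3.2 (mul_le_mul_of_nonneg_left ?_ hpos.le)
    exact_mod_cast h7

theorem IsDyadicCube.subset_or_subset_or_disjoint {P Q : Set (Fin n → ℝ)}
    (hP : IsDyadicCube n P) (hQ : IsDyadicCube n Q) : P ⊆ Q ∨ Q ⊆ P ∨ Disjoint P Q := by
  obtain ⟨k, m, rfl⟩ := hP
  obtain ⟨l, m', rfl⟩ := hQ
  by_cases hd : Disjoint (dyadicCube n k m) (dyadicCube n l m')
  · exact Or.inr (Or.inr hd)
  obtain ⟨x, hx, hx'⟩ := not_disjoint_iff.1 hd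
  rcases le_total k l with h | h
  · exact Or.inr (Or.inl (dyadicCube_subset_of_le h hx hx'))
  · exact Or.inl (dyadicCube_subset_of_le h hx' hx)

theorem countable_isDyadicCube : {Q | IsDyadicCube n Q}.Countable := by
  refine (countable_range fun z : ℤ × (Fin n → ℤ) => dyadicCube n z.1 z.2).mono ?_
  rintro _ ⟨k, m, rfl⟩
  exact ⟨(k, m), rfl⟩

theorem dyadicCube_eq_of_mem {k : ℤ} {m m' : Fin n → ℤ} {x : Fin n → ℝ}
    (hx : x ∈ dyadicCube n k m) (hx' : x ∈ dyadicCube n k m') :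
    dyadicCube n k m = dyadicCube n k m' :=
  (dyadicCube_subset_of_le le_rfl hx' hx).antisymm (dyadicCube_subset_of_le le_rfl hx hx')

theorem finite_isDyadicCube_between {P Q : Set (Fin n → ℝ)} (hP : IsDyadicCube n P)
    (hQ : IsDyadicCube n Q) : {R | IsDyadicCube n R ∧ P ⊆ R ∧ R ⊆ Q}.Finite := by
  classical
  obtain ⟨x, hx⟩ := hP.nonempty
  obtain ⟨a, b, rfl⟩ := hP
  obtain ⟨c, d, rfl⟩ := hQ
  have hlev : ∀ l : ℤ, {R | (∃ m, R = dyadicCube n l m) ∧ x ∈ R}.Finite := by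
    intro l
    refine Set.Subsingleton.finite ?_
    rintro _ ⟨⟨m, rfl⟩, hm⟩ _ ⟨⟨m', rfl⟩, hm'⟩
    exact dyadicCube_eq_of_mem hm hm'
  refine (((finite_Icc c a).biUnion fun l _ => hlev l).union
    (toFinite {dyadicCube n a b, dyadicCube n c d})).subset ?_
  rintro _ ⟨⟨l, m, rfl⟩, hPR, hRQ⟩
  have hxR := hPR hx
  by_cases h1 : l < c
  · exact Or.inr (Or.inr (hRQ.antisymm (dyadicCube_subset_of_le h1.le hxR (hRQ hxR))))
  by_cases h2 : a < l
  · exact Or.inr (Or.inl ((dyadicCube_subset_of_le h2.le hx hxR).antisymm hPR))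
  exact Or.inl (mem_biUnion (show l ∈ Icc c a from ⟨not_lt.1 h1, not_lt.1 h2⟩) ⟨⟨m, rfl⟩, hxR⟩)

/-- The part of `Q` that is not covered by the elements of `S` strictly contained in `Q`. -/
def sparseCore {α : Type*} (S : Set (Set α)) (Q : Set α) : Set α :=
  Q \ ⋃ P ∈ sparseMaximals S Q, P

theorem sparseCore_subset {α : Type*} (S : Set (Set α)) (Q : Set α) : sparseCore S Q ⊆ Q :=
  sdiff_subset

section Sparse

variable {S : Set (Set (Fin n → ℝ))} (hS : ∀ Q ∈ S, IsDyadicCube n Q)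

include hS

theorem countable_of_isDyadicCube : S.Countable :=
  countable_isDyadicCube.mono hS

theorem exists_subset_sparseMaximals {P Q : Set (Fin n → ℝ)} (hP : P ∈ S) (hQ : Q ∈ S)
    (hPQ : P ⊂ Q) : ∃ R ∈ sparseMaximals S Q, P ⊆ R := by
  have hfin : {R | R ∈ S ∧ P ⊆ R ∧ R ⊂ Q}.Finite :=
    (finite_isDyadicCube_between (hS P hP) (hS Q hQ)).subset
      fun R hR => ⟨hS R hR.1, hR.2.1, hR.2.2.subset⟩
  obtain ⟨R, hPR, hR⟩ := hfin.exists_le_maximal (a := P) ⟨hP, Subset.rfl, hPQ⟩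
  refine ⟨R, ⟨hR.1.1, hR.1.2.2, fun R' hR' hR'Q hRR' => ?_⟩, hPR⟩
  exact hR.eq_of_subset ⟨hR', hPR.trans hRR', hR'Q⟩ hRR'

theorem countable_sparseMaximals (Q : Set (Fin n → ℝ)) : (sparseMaximals S Q).Countable :=
  (countable_of_isDyadicCube hS).mono fun _ hP => hP.1

theorem measurableSet_sparseCore {Q : Set (Fin n → ℝ)} (hQ : Q ∈ S) :
    MeasurableSet (sparseCore S Q) :=
  (hS Q hQ).measurableSet.diff
    (.biUnion (countable_sparseMaximals hS Q) fun P hP => (hS P hP.1).measurableSet)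

theorem pairwiseDisjoint_sparseCore : S.PairwiseDisjoint (sparseCore S) := by
  have key : ∀ P ∈ S, ∀ Q ∈ S, P ⊂ Q → Disjoint (sparseCore S P) (sparseCore S Q) := by
    intro P hP Q hQ hPQ
    obtain ⟨R, hR, hPR⟩ := exists_subset_sparseMaximals hS hP hQ hPQ
    exact disjoint_left.2 fun x hxP hxQ =>
      hxQ.2 (mem_biUnion hR (hPR (sparseCore_subset S P hxP)))
  intro P hP Q hQ hne
  rcases (hS P hP).subset_or_subset_or_disjoint (hS Q hQ) with h | h | h
  · exact key P hP Q hQ (h.ssubset_of_ne hne)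
  · exact (key Q hQ P hP (h.ssubset_of_ne hne.symm)).symm
  · exact h.mono (sparseCore_subset S P) (sparseCore_subset S Q)

theorem volume_le_two_mul_sparseCore (hsp : IsSparse S) {Q : Set (Fin n → ℝ)} (hQ : Q ∈ S) :
    volume Q ≤ 2 * volume (sparseCore S Q) := by
  have hc := countable_sparseMaximals hS Q
  have h1 : volume (⋃ P ∈ sparseMaximals S Q, P) ≤ volume Q / 2 :=
    (measure_biUnion_le volume hc fun P => P).trans (hsp Q hQ)
  have h2 : volume Q ≤ volume (sparseCore S Q) + volume Q / 2 :=
    (measure_le_inter_add_sdiff volume Q (⋃ P ∈ sparseMaximals S Q, P)).trans (by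
      rw [add_comm]
      gcongr
      · exact Subset.rfl
      · exact (measure_mono inter_subset_right).trans h1)
  have hfin : volume Q / 2 ≠ ∞ := ENNReal.div_ne_top (hS Q hQ).volume_ne_top (by norm_num)
  have h3 : volume Q / 2 ≤ volume (sparseCore S Q) := by
    rw [← ENNReal.add_le_add_iff_right hfin, ENNReal.add_halves]
    exact h2
  rw [mul_comm]
  exact (ENNReal.div_le_iff_le_mul (by simp) (by simp)).1 h3

end Sparse

end Dyadic

theorem rpow_le_exp_mul_rpow_add {a : ℝ≥0∞} (ha : a ≤ 1) {q r L C M : ℝ} (hq : 1 ≤ q)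
    (hL : Real.exp 1 ≤ L) (hM : 0 ≤ M) (h : |q - r| ≤ C / Real.log L) :
    a ^ q ≤ ENNReal.ofReal (Real.exp (M * C)) * a ^ r + ENNReal.ofReal (L ^ (-M)) := by
  have hL0 : 0 < L := (Real.exp_pos 1).trans_le hL
  have hlog : 0 < Real.log L :=
    Real.log_pos (lt_of_lt_of_le (by simp) hL)
  rcases le_or_gt a (ENNReal.ofReal (L ^ (-M))) with h1 | h1
  · refine le_add_left (le_trans ?_ h1)
    simpa using ENNReal.rpow_le_rpow_of_exponent_ge ha hq
  · refine le_add_right ?_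
    obtain ⟨b, rfl⟩ : ∃ b : NNReal, a = b :=
      ⟨_, (ENNReal.coe_toNNReal (ne_top_of_le_ne_top one_ne_top ha)).symm⟩
    have hbL : L ^ (-M) < b := by
      rwa [← ENNReal.ofReal_coe_nnreal, ENNReal.ofReal_lt_ofReal_iff_of_nonneg (by positivity)]
        at h1
    have hb0 : (0 : ℝ) < b := lt_of_le_of_lt (by positivity) hbL
    have hb1 : (b : ℝ) ≤ 1 := by exact_mod_cast ha
    have hlogb : |Real.log b| ≤ M * Real.log L := by
      rw [abs_of_nonpos (Real.log_nonpos hb0.le hb1)]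
      have := Real.log_le_log (by positivity) hbL.le
      rw [Real.log_rpow hL0] at this
      linarith
    have hexp : (b : ℝ) ^ (q - r) ≤ Real.exp (M * C) := by
      rw [Real.rpow_def_of_pos hb0]
      refine Real.exp_le_exp.2 ((le_abs_self _).trans ?_)
      rw [abs_mul]
      calc |Real.log b| * |q - r| ≤ (M * Real.log L) * (C / Real.log L) := by gcongr
        _ = M * C := by field_simp
    rw [← ENNReal.ofReal_coe_nnreal, ENNReal.ofReal_rpow_of_pos hb0, ENNReal.ofReal_rpow_of_pos hb0,
      ← ENNReal.ofReal_mul (Real.exp_pos _).le]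
    refine ENNReal.ofReal_le_ofReal ?_
    calc (b : ℝ) ^ q = b ^ (q - r) * b ^ r := by rw [← Real.rpow_add hb0]; congr 1; ring
      _ ≤ _ := by gcongr

theorem setLAverage_rpow_le {α : Type*} [MeasurableSpace α] {μ : Measure α} {Q : Set α}
    (h0 : μ Q ≠ 0) (htop : μ Q ≠ ∞) {h : α → ℝ≥0∞} (hh : Measurable h) {ρ : ℝ} (hρ : 1 ≤ ρ) :
    (⨍⁻ x in Q, h x ∂μ) ^ ρ ≤ ⨍⁻ x in Q, h x ^ ρ ∂μ := by
  have : NeZero (μ.restrict Q) := ⟨by simpa using h0⟩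
  have : IsFiniteMeasure (μ.restrict Q) := ⟨by simpa using htop.lt_top⟩
  have hρ0 : 0 < ρ := by linarith
  have key := eLpNorm'_le_eLpNorm'_of_exponent_le (f := h) zero_lt_one hρ
    ((μ.restrict Q univ)⁻¹ • μ.restrict Q) hh.aestronglyMeasurable
  simp only [eLpNorm', enorm_eq_self, rpow_one, div_one, one_div] at key
  calc _ ≤ ((∫⁻ x, h x ^ ρ ∂((μ.restrict Q univ)⁻¹ • μ.restrict Q)) ^ ρ⁻¹) ^ ρ :=
        ENNReal.rpow_le_rpow key hρ0.le
    _ = _ := by rw [← ENNReal.rpow_mul, inv_mul_cancel₀ hρ0.ne', rpow_one]; rfl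

theorem rpow_mul_rpow_neg_le {v η B s qm qp q b C₀ : ℝ} (hv : 0 < v) (hη : 0 < η) (hηB : η ≤ B)
    (hB : 1 ≤ B) (hs : 1 ≤ s) (hsq : s ≤ qm) (hmq : qm ≤ q) (hqp : q ≤ qp) (hqb : q ≤ b)
    (hC : (v / η) ^ (qm - qp) ≤ C₀) :
    η ^ q * v ^ (-((q - qm) / (qm / s))) ≤ max 1 C₀ * B ^ b := by
  have hqm : 0 < qm := by linarith
  set e := (q - qm) / (qm / s) with he
  have he0 : 0 ≤ e := div_nonneg (by linarith) (by positivity)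
  have heq : e ≤ q - qm := div_le_self (by linarith) ((one_le_div (by linarith)).2 hsq)
  have hva : 0 < v / η := by positivity
  have h1 : (v / η) ^ (-e) ≤ max 1 C₀ := by
    rcases le_total 1 (v / η) with h | h
    · exact (Real.rpow_le_one_of_one_le_of_nonpos h (by linarith)).trans (le_max_left _ _)
    · exact ((Real.rpow_le_rpow_of_exponent_ge hva h (by linarith)).trans hC).trans
        (le_max_right _ _)
  have h2 : η ^ (q - e) ≤ B ^ b :=
    (Real.rpow_le_rpow hη.le hηB (by linarith)).trans
      (Real.rpow_le_rpow_of_exponent_le hB (by linarith))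
  calc η ^ q * v ^ (-e) = (v / η) ^ (-e) * η ^ (q - e) := by
        rw [Real.div_rpow hv.le hη.le, Real.rpow_sub hη, Real.rpow_neg hη.le, Real.rpow_neg hv.le]
        field_simp
    _ ≤ _ := by gcongr

/-- The part of the estimate which uses the local log-Hölder type condition: on a set `Q`, the
average of a function with values in `{0} ∪ [1, ∞]` may be raised to a variable power. -/
theorem ae_restrict_laverage_rpow_le {α : Type*} [MeasurableSpace α] {μ : Measure α} {Q : Set α}
    (h0 : μ Q ≠ 0) (htop : μ Q ≠ ∞) {η B s qm qp b C₀ : ℝ} (hη : 0 < η) (hηB : η ≤ B)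
    (hB : 1 ≤ B) (hs : 1 ≤ s) (hsq : s ≤ qm) {q : α → ℝ}
    (hqm : ∀ᵐ x ∂μ.restrict Q, qm ≤ q x ∧ q x ≤ qp) (hqb : ∀ᵐ x ∂μ.restrict Q, q x ≤ b)
    (hC : ((μ Q).toReal / η) ^ (qm - qp) ≤ C₀)
    {h : α → ℝ≥0∞} (hh : Measurable h) (h01 : ∀ x, h x = 0 ∨ 1 ≤ h x)
    (hint : ∫⁻ x, h x ^ q x ∂μ ≤ 1) :
    ∀ᵐ x ∂μ.restrict Q, (ENNReal.ofReal η * ⨍⁻ y in Q, h y ∂μ) ^ q x ≤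
      ENNReal.ofReal (max 1 C₀ * B ^ b) * (⨍⁻ y in Q, h y ^ (q y / s) ∂μ) ^ s := by
  have hs0 : 0 < s := by linarith
  have hqm0 : 0 < qm := by linarith
  set ρ := qm / s with hρdef
  have hρ : 1 ≤ ρ := (one_le_div hs0).2 hsq
  have hmono : ∀ (a : ℝ≥0∞), (a = 0 ∨ 1 ≤ a) → ∀ {c d : ℝ}, 0 < c → c ≤ d → a ^ c ≤ a ^ d := by
    rintro a (rfl | ha) c d hc hcd
    · simp [ENNReal.zero_rpow_of_pos hc]
    · exact ENNReal.rpow_le_rpow_of_exponent_le ha hcd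
  set G := ⨍⁻ y in Q, h y ^ (q y / s) ∂μ with hG
  have hmG : (⨍⁻ y in Q, h y ∂μ) ^ ρ ≤ G := by
    refine (setLAverage_rpow_le h0 htop hh hρ).trans ?_
    rw [hG, setLAverage_eq, setLAverage_eq]
    gcongr ?_ / _
    refine lintegral_mono_ae ?_
    filter_upwards [hqm] with y hy
    exact hmono _ (h01 y) (by positivity) (div_le_div_of_nonneg_right hy.1 hs0.le)
  have hGv : G ≤ (μ Q)⁻¹ := by
    rw [hG, setLAverage_eq, ← one_div]
    gcongr ?_ / _
    refine le_trans ?_ ((setLIntegral_le_lintegral Q _).trans hint)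
    refine lintegral_mono_ae ?_
    filter_upwards [hqm] with y hy
    have : 0 < q y := by linarith
    exact hmono _ (h01 y) (by positivity) (div_le_self this.le hs)
  have hv : 0 < (μ Q).toReal := ENNReal.toReal_pos h0 htop
  filter_upwards [hqm, hqb] with x hx hxb
  set m := ⨍⁻ y in Q, h y ∂μ
  set e := (q x - qm) / ρ with he
  have hqx : 0 < q x := by linarith
  have he0 : 0 ≤ e := div_nonneg (by linarith [hx.1]) (by positivity)
  have hse : q x = ρ * (s + e) := by
    rw [he, mul_add, mul_div_cancel₀ _ (by positivity), hρdef, div_mul_cancel₀ _ hs0.ne']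
    ring
  have hmq : m ^ q x ≤ G ^ s * ENNReal.ofReal ((μ Q).toReal ^ (-e)) := by
    calc m ^ q x = (m ^ ρ) ^ (s + e) := by rw [← ENNReal.rpow_mul, ← hse]
      _ ≤ G ^ (s + e) := ENNReal.rpow_le_rpow hmG (by linarith)
      _ = G ^ s * G ^ e := ENNReal.rpow_add_of_nonneg _ _ hs0.le he0
      _ ≤ G ^ s * ((μ Q)⁻¹) ^ e := by gcongr
      _ = _ := by
        rw [← ENNReal.ofReal_rpow_of_pos hv, ENNReal.ofReal_toReal htop, ENNReal.inv_rpow,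
          ENNReal.rpow_neg]
  calc (ENNReal.ofReal η * m) ^ q x = ENNReal.ofReal (η ^ q x) * m ^ q x := by
        rw [ENNReal.mul_rpow_of_nonneg _ _ hqx.le, ENNReal.ofReal_rpow_of_pos hη]
    _ ≤ ENNReal.ofReal (η ^ q x) * (G ^ s * ENNReal.ofReal ((μ Q).toReal ^ (-e))) := by gcongr
    _ = ENNReal.ofReal (η ^ q x * (μ Q).toReal ^ (-e)) * G ^ s := by
        rw [ENNReal.ofReal_mul (by positivity)]; ring
    _ ≤ _ := by
        gcongr ENNReal.ofReal ?_ * _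
        exact rpow_mul_rpow_neg_le hv hη hηB hB hs hsq hx.1 hx.2 hxb hC

section Sparse

variable {n : ℕ} {S : Set (Set (Fin n → ℝ))} (hS : ∀ Q ∈ S, IsDyadicCube n Q)

include hS

theorem tsum_laverage_rpow_mul_sparseCore_le {s : ℝ} (hs : 1 < s) {h : (Fin n → ℝ) → ℝ≥0∞}
    (hh : Measurable h) (hhtop : ∀ x, h x ≠ ∞) :
    ∑' Q : S, (⨍⁻ x in (Q : Set (Fin n → ℝ)), h x ∂volume) ^ s * volume (sparseCore S Q) ≤
      ENNReal.ofReal (2 ^ s * s / (s - 1)) * ∫⁻ x, h x ^ s := by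
  classical
  rw [ENNReal.tsum_eq_iSup_sum]
  refine iSup_le fun T => ?_
  have hTS : ∀ Q ∈ T.map (Function.Embedding.subtype (· ∈ S)), Q ∈ S := by
    intro Q hQ
    obtain ⟨a, -, rfl⟩ := Finset.mem_map.1 hQ
    exact a.2
  have := sum_laverage_rpow_mul_le (μ := volume) hs (T.map (Function.Embedding.subtype (· ∈ S)))
    (fun P hP Q hQ => (hS P (hTS P hP)).subset_or_subset_or_disjoint (hS Q (hTS Q hQ)))
    (fun Q hQ => (hS Q (hTS Q hQ)).measurableSet) (fun Q hQ => (hS Q (hTS Q hQ)).volume_ne_top)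
    (sparseCore S) (fun Q _ => sparseCore_subset S Q)
    (fun Q hQ => measurableSet_sparseCore hS (hTS Q hQ))
    ((pairwiseDisjoint_sparseCore hS).subset fun Q hQ => hTS Q (Finset.mem_coe.1 hQ)) h hh hhtop
  rwa [Finset.sum_map] at this

theorem tsum_setLIntegral_sparseCore_le (w : (Fin n → ℝ) → ℝ≥0∞) :
    ∑' Q : S, ∫⁻ x in sparseCore S Q, w x ≤ ∫⁻ x, w x := by
  have : Countable S := (countable_of_isDyadicCube hS).to_subtype
  rw [← lintegral_iUnion (fun Q : S => measurableSet_sparseCore hS Q.2)]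
  · exact setLIntegral_le_lintegral _ _
  · intro P Q hPQ
    exact pairwiseDisjoint_sparseCore hS P.2 Q.2 (Subtype.coe_injective.ne hPQ)

end Sparse

theorem lintegral_exp_one_add_norm_rpow_lt_top (n : ℕ) :
    ∫⁻ x : Fin n → ℝ, ENNReal.ofReal ((Real.exp 1 + ‖x‖) ^ (-((n : ℝ) + 1))) < ∞ := by
  refine lt_of_le_of_lt (lintegral_mono fun x => ?_)
    (finite_integral_one_add_norm (E := Fin n → ℝ) (μ := volume) (r := (n : ℝ) + 1) (by simp))
  refine ENNReal.ofReal_le_ofReal (Real.rpow_le_rpow_of_nonpos (by positivity) ?_ ?_)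
  · gcongr
    exact Real.one_le_exp zero_le_one
  · have : (0 : ℝ) ≤ n := n.cast_nonneg
    linarith

/-- The modular estimate for the dyadic averages of `h`, localised to the sparse cores. -/
theorem exists_tsum_setLIntegral_laverage_rpow_le {n : ℕ} {S : Set (Set (Fin n → ℝ))}
    (hS : ∀ Q ∈ S, IsDyadicCube n Q) {η : Set (Fin n → ℝ) → ℝ} {B : ℝ}
    (hη : ∀ Q ∈ S, 0 < η Q) (hηB : ∀ Q ∈ S, η Q ≤ B) (hB : 1 ≤ B)
    {q : (Fin n → ℝ) → ℝ} (hq : Measurable q) (hq0 : ∀ x, 0 ≤ q x)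
    {s b : ℝ} (hs : 1 < s) (hsq : ∀ᵐ x, s ≤ q x) (hqb : ∀ᵐ x, q x ≤ b) {C₀ : ℝ}
    (hloc : ∀ Q ∈ S, ∃ qm qp : ℝ, s ≤ qm ∧ (∀ᵐ x ∂volume.restrict Q, qm ≤ q x ∧ q x ≤ qp) ∧
      ((volume Q).toReal / η Q) ^ (qm - qp) ≤ C₀)
    {Cinf qinf : ℝ} (hqinf : s ≤ qinf)
    (hinf : ∀ᵐ x, |q x - qinf| ≤ Cinf / Real.log (Real.exp 1 + ‖x‖)) :
    ∃ K : ℝ≥0∞, K ≠ ∞ ∧ ∀ h : (Fin n → ℝ) → ℝ≥0∞, Measurable h → (∀ x, h x ≠ ∞) →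
      ∫⁻ x, h x ^ q x ≤ 1 →
      ∑' Q : S, ∫⁻ x in sparseCore S Q,
        (ENNReal.ofReal (η Q) * ⨍⁻ y in (Q : Set (Fin n → ℝ)), h y ∂volume) ^ q x ≤ K := by
  set M : ℝ := (n : ℝ) + 1 with hM
  have hM0 : 0 ≤ M := by positivity
  set w : (Fin n → ℝ) → ℝ≥0∞ := fun x => ENNReal.ofReal ((Real.exp 1 + ‖x‖) ^ (-M)) with hw
  have hwm : Measurable w := by fun_prop
  have hW : ∫⁻ x, w x < ∞ := lintegral_exp_one_add_norm_rpow_lt_top n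
  set W := ∫⁻ x, w x with hWdef
  set A := ENNReal.ofReal (Real.exp (M * Cinf)) with hA
  set K₁ := ENNReal.ofReal (max 1 C₀ * B ^ b) with hK₁
  set Cs := ENNReal.ofReal (2 ^ s * s / (s - 1)) with hCs
  set Cq := ENNReal.ofReal (2 ^ qinf * qinf / (qinf - 1)) with hCq
  set D := ENNReal.ofReal (2 ^ b) with hD
  set Bb := ENNReal.ofReal (B ^ b) with hBb
  have hL : ∀ x : Fin n → ℝ, Real.exp 1 ≤ Real.exp 1 + ‖x‖ := fun x => by simp
  refine ⟨D * (K₁ * Cs + Bb * (A * (Cq * (A + W)) + W)), ?_, fun h hh hhtop hint => ?_⟩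
  · have := hW.ne
    finiteness
  set h₁ : (Fin n → ℝ) → ℝ≥0∞ := {x | 1 < h x}.indicator h with hh₁
  set h₂ : (Fin n → ℝ) → ℝ≥0∞ := {x | 1 < h x}ᶜ.indicator h with hh₂
  have hmeas : MeasurableSet {x | 1 < h x} := measurableSet_lt measurable_const hh
  have hm₁ : Measurable h₁ := hh.indicator hmeas
  have hm₂ : Measurable h₂ := hh.indicator hmeas.compl
  have hsum : ∀ x, h x = h₁ x + h₂ x := fun x =>
    (congrFun (indicator_self_add_compl {x | 1 < h x} h) x).symm
  have hle₁ : ∀ x, h₁ x ≤ h x := fun x => indicator_le_self _ _ _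
  have hle₂ : ∀ x, h₂ x ≤ h x := fun x => indicator_le_self _ _ _
  have h01 : ∀ x, h₁ x = 0 ∨ 1 ≤ h₁ x := by
    intro x
    by_cases hx : 1 < h x
    · exact Or.inr (by simpa [hh₁, hx] using hx.le)
    · exact Or.inl (by simp [hh₁, hx])
  have hone : ∀ x, h₂ x ≤ 1 := by
    intro x
    by_cases hx : 1 < h x
    · simp [hh₂, hx]
    · simpa [hh₂, indicator, hx] using not_lt.1 hx
  have hint₁ : ∫⁻ x, h₁ x ^ q x ≤ 1 :=
    (lintegral_mono fun x => ENNReal.rpow_le_rpow (hle₁ x) (hq0 x)).trans hint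
  have hint₂ : ∫⁻ x, h₂ x ^ q x ≤ 1 :=
    (lintegral_mono fun x => ENNReal.rpow_le_rpow (hle₂ x) (hq0 x)).trans hint
  have hint₃ : ∫⁻ x, h₂ x ^ qinf ≤ A + W := by
    calc ∫⁻ x, h₂ x ^ qinf ≤ ∫⁻ x, (A * h₂ x ^ q x + w x) := by
          refine lintegral_mono_ae ?_
          filter_upwards [hinf] with x hx
          rw [abs_sub_comm] at hx
          exact rpow_le_exp_mul_rpow_add (hone x) (by linarith) (hL x) hM0 hx
      _ = A * (∫⁻ x, h₂ x ^ q x) + W := by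
          rw [lintegral_add_right _ hwm, lintegral_const_mul _ (by fun_prop)]
      _ ≤ A * 1 + W := by gcongr
      _ = A + W := by rw [mul_one]
  set g : (Fin n → ℝ) → ℝ≥0∞ := fun x => h₁ x ^ (q x / s) with hg
  have hgm : Measurable g := by fun_prop
  have hgtop : ∀ x, g x ≠ ∞ := fun x => ENNReal.rpow_ne_top_of_nonneg
    (div_nonneg (hq0 x) (by linarith)) (ne_top_of_le_ne_top (hhtop x) (hle₁ x))
  have hgs : ∫⁻ x, g x ^ s ≤ 1 := by
    refine le_trans (le_of_eq (lintegral_congr fun x => ?_)) hint₁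
    rw [hg, ← ENNReal.rpow_mul, div_mul_cancel₀ _ (by linarith)]
  have hQ : ∀ Q ∈ S, ∫⁻ x in sparseCore S Q,
      (ENNReal.ofReal (η Q) * ⨍⁻ y in Q, h y ∂volume) ^ q x ≤
      D * (K₁ * ((⨍⁻ y in Q, g y ∂volume) ^ s * volume (sparseCore S Q)) +
        Bb * (A * ((⨍⁻ y in Q, h₂ y ∂volume) ^ qinf * volume (sparseCore S Q)) +
          ∫⁻ x in sparseCore S Q, w x)) := by
    intro Q hQS
    obtain ⟨qm, qp, hsqm, hqm, hC⟩ := hloc Q hQS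
    have hv0 := (hS Q hQS).volume_ne_zero
    have hvtop := (hS Q hQS).volume_ne_top
    have hlocal := ae_restrict_laverage_rpow_le hv0 hvtop (hη Q hQS) (hηB Q hQS) hB hs.le hsqm hqm
      (ae_restrict_of_ae hqb) hC hm₁ h01 hint₁
    have hsplit : ⨍⁻ y in Q, h y ∂volume =
        ⨍⁻ y in Q, h₁ y ∂volume + ⨍⁻ y in Q, h₂ y ∂volume := by
      simp only [setLAverage_eq]
      rw [← ENNReal.add_div, ← lintegral_add_left hm₁]
      simp only [hsum]
    have hm₂one : ⨍⁻ y in Q, h₂ y ∂volume ≤ 1 := by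
      rw [setLAverage_eq]
      refine ENNReal.div_le_of_le_mul ?_
      calc ∫⁻ y in Q, h₂ y ≤ ∫⁻ _ in Q, 1 := lintegral_mono hone
        _ = 1 * volume Q := by simp
    have hpt : ∀ᵐ x ∂volume.restrict Q,
        (ENNReal.ofReal (η Q) * ⨍⁻ y in Q, h y ∂volume) ^ q x ≤
        D * (K₁ * (⨍⁻ y in Q, g y ∂volume) ^ s +
          Bb * (A * (⨍⁻ y in Q, h₂ y ∂volume) ^ qinf + w x)) := by
      filter_upwards [hlocal, ae_restrict_of_ae hinf, ae_restrict_of_ae hsq, ae_restrict_of_ae hqb]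
        with x hx hxinf hxs hxb
      have hx1 : 1 ≤ q x := hs.le.trans hxs
      rw [hsplit, mul_add]
      refine (ENNReal.rpow_add_le_mul_rpow_add_rpow _ _ hx1).trans ?_
      gcongr ?_ * (?_ + ?_)
      · rw [hD, ← ENNReal.ofReal_rpow_of_pos (by norm_num), ENNReal.ofReal_ofNat]
        exact ENNReal.rpow_le_rpow_of_exponent_le (by norm_num) (by linarith)
      · rw [ENNReal.mul_rpow_of_nonneg _ _ (hq0 x)]
        gcongr ?_ * ?_
        · rw [ENNReal.ofReal_rpow_of_pos (hη Q hQS)]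
          refine ENNReal.ofReal_le_ofReal ?_
          exact (Real.rpow_le_rpow (hη Q hQS).le (hηB Q hQS) (hq0 x)).trans
            (Real.rpow_le_rpow_of_exponent_le hB hxb)
        · exact rpow_le_exp_mul_rpow_add hm₂one hx1 (hL x) hM0 hxinf
    calc _ ≤ ∫⁻ x in sparseCore S Q, D * (K₁ * (⨍⁻ y in Q, g y ∂volume) ^ s +
          Bb * (A * (⨍⁻ y in Q, h₂ y ∂volume) ^ qinf + w x)) :=
          lintegral_mono_ae (ae_restrict_of_ae_restrict_of_subset (sparseCore_subset S Q) hpt)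
      _ = _ := by
        rw [lintegral_const_mul _ (by fun_prop), lintegral_add_left measurable_const,
          lintegral_const_mul Bb (by fun_prop), lintegral_add_left measurable_const]
        simp only [setLIntegral_const, mul_assoc]
  calc _ ≤ ∑' Q : S, D * (K₁ * ((⨍⁻ y in (Q : Set (Fin n → ℝ)), g y ∂volume) ^ s *
          volume (sparseCore S Q)) +
        Bb * (A * ((⨍⁻ y in (Q : Set (Fin n → ℝ)), h₂ y ∂volume) ^ qinf *
          volume (sparseCore S Q)) + ∫⁻ x in sparseCore S Q, w x)) :=
        ENNReal.tsum_le_tsum fun Q => hQ Q Q.2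
    _ ≤ D * (K₁ * (Cs * 1) + Bb * (A * (Cq * (A + W)) + W)) := by
        simp only [ENNReal.tsum_mul_left, ENNReal.tsum_add]
        gcongr
        · exact (tsum_laverage_rpow_mul_sparseCore_le hS hs hgm hgtop).trans (by gcongr)
        · exact (tsum_laverage_rpow_mul_sparseCore_le hS (hs.trans_le hqinf) hm₂
            fun x => ne_top_of_le_ne_top (hhtop x) (hle₂ x)).trans (by gcongr)
        · exact tsum_setLIntegral_sparseCore_le hS w
    _ = _ := by rw [mul_one]

/-- The `ε`-sparse operator with values in `[0, ∞]`. -/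
def lsparseOp {α : Type*} [MeasureSpace α] (ε : Set α → ℝ) (S : Set (Set α))
    (f : α → ℝ≥0∞) (x : α) : ℝ≥0∞ :=
  ∑' Q : S, (Q : Set α).indicator
    (fun _ => ENNReal.ofReal (ε Q) * ⨍⁻ y in (Q : Set α), f y ∂volume) x

theorem ofReal_sparseOp_le {α : Type*} [MeasureSpace α] {ε : Set α → ℝ} {S : Set (Set α)}
    (hε : ∀ Q ∈ S, 0 ≤ ε Q) (hS : ∀ Q ∈ S, volume Q ≠ 0) (hS' : ∀ Q ∈ S, volume Q ≠ ∞)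
    {f : α → ℝ} (hf : Measurable f) (hf0 : ∀ x, 0 ≤ f x) (x : α) :
    ENNReal.ofReal (sparseOp ε S f x) ≤ lsparseOp ε S (fun y => ENNReal.ofReal (f y)) x := by
  have hint : ∀ Q : Set α, 0 ≤ ∫ y in Q, f y := fun Q => integral_nonneg hf0
  have hnn : ∀ Q : S, 0 ≤ (Q : Set α).indicator
      (fun _ => ε Q * (((volume (Q : Set α)).toReal)⁻¹ * ∫ y in (Q : Set α), f y ∂volume)) x :=
    fun Q => indicator_nonneg (fun _ _ => mul_nonneg (hε Q Q.2)
      (mul_nonneg (by positivity) (hint Q))) x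
  by_cases hsum : Summable fun Q : S => (Q : Set α).indicator
      (fun _ => ε Q * (((volume (Q : Set α)).toReal)⁻¹ * ∫ y in (Q : Set α), f y ∂volume)) x
  swap
  · rw [sparseOp, tsum_eq_zero_of_not_summable hsum]
    simp
  rw [sparseOp, ENNReal.ofReal_tsum_of_nonneg hnn hsum, lsparseOp]
  refine ENNReal.tsum_le_tsum fun Q => ?_
  by_cases hx : x ∈ (Q : Set α)
  swap
  · simp [hx]
  rw [indicator_of_mem hx, indicator_of_mem hx, ENNReal.ofReal_mul (hε Q Q.2)]
  gcongr
  rw [ENNReal.ofReal_mul (by positivity), ENNReal.ofReal_inv_of_pos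
    (ENNReal.toReal_pos (hS Q Q.2) (hS' Q Q.2)), ENNReal.ofReal_toReal (hS' Q Q.2),
    setLAverage_eq, mul_comm, ← div_eq_mul_inv]
  gcongr
  rw [integral_eq_lintegral_of_nonneg_ae (.of_forall hf0) hf.aestronglyMeasurable]
  exact ENNReal.ofReal_toReal_le

theorem lsparseOp_const_mul {α : Type*} [MeasureSpace α] (ε : Set α → ℝ) (S : Set (Set α))
    {f : α → ℝ≥0∞} (hf : Measurable f) (c : ℝ≥0∞) (x : α) :
    lsparseOp ε S (fun y => c * f y) x = c * lsparseOp ε S f x := by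
  rw [lsparseOp, lsparseOp, ← ENNReal.tsum_mul_left]
  refine tsum_congr fun Q => ?_
  by_cases hx : x ∈ (Q : Set α)
  · rw [indicator_of_mem hx, indicator_of_mem hx, setLAverage_eq, setLAverage_eq,
      lintegral_const_mul _ hf, mul_div_assoc]
    ring
  · simp [hx]

section Sparse

variable {n : ℕ} {S : Set (Set (Fin n → ℝ))} (hS : ∀ Q ∈ S, IsDyadicCube n Q)

include hS

theorem measurable_lsparseOp (ε : Set (Fin n → ℝ) → ℝ) (f : (Fin n → ℝ) → ℝ≥0∞) :
    Measurable (lsparseOp ε S f) := by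
  have : Countable S := (countable_of_isDyadicCube hS).to_subtype
  exact Measurable.tsum fun Q => measurable_const.indicator (hS Q Q.2).measurableSet

theorem lintegral_lsparseOp_mul_le (hsp : IsSparse S) {ε η : Set (Fin n → ℝ) → ℝ}
    (hη : ∀ Q ∈ S, 0 ≤ η Q) (hηε : ∀ Q ∈ S, η Q * η Q = ε Q)
    (f : (Fin n → ℝ) → ℝ≥0∞) {g : (Fin n → ℝ) → ℝ≥0∞} (hg : Measurable g) :
    ∫⁻ x, lsparseOp ε S f x * g x ≤
      2 * ∑' Q : S, (ENNReal.ofReal (η Q) * ⨍⁻ y in (Q : Set (Fin n → ℝ)), f y ∂volume) *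
        (ENNReal.ofReal (η Q) * ⨍⁻ y in (Q : Set (Fin n → ℝ)), g y ∂volume) *
          volume (sparseCore S Q) := by
  have : Countable S := (countable_of_isDyadicCube hS).to_subtype
  have hind : ∀ (Q : S) (x : Fin n → ℝ), (Q : Set (Fin n → ℝ)).indicator
      (fun _ => ENNReal.ofReal (ε Q) * ⨍⁻ y in (Q : Set (Fin n → ℝ)), f y ∂volume) x * g x =
      (Q : Set (Fin n → ℝ)).indicator (fun z => (ENNReal.ofReal (ε Q) *
        ⨍⁻ y in (Q : Set (Fin n → ℝ)), f y ∂volume) * g z) x := by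
    intro Q x
    by_cases hx : x ∈ (Q : Set (Fin n → ℝ)) <;> simp [hx]
  simp only [lsparseOp, ← ENNReal.tsum_mul_right, hind]
  rw [lintegral_tsum fun Q : S =>
      ((hg.const_mul _).indicator (hS Q Q.2).measurableSet).aemeasurable,
    ← ENNReal.tsum_mul_left]
  refine ENNReal.tsum_le_tsum fun Q => ?_
  have hQ := hS Q Q.2
  rw [lintegral_indicator hQ.measurableSet, lintegral_const_mul _ hg, ← hηε Q Q.2,
    ENNReal.ofReal_mul (hη Q Q.2)]
  have hgQ : ∫⁻ y in (Q : Set (Fin n → ℝ)), g y ≤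
      (⨍⁻ y in (Q : Set (Fin n → ℝ)), g y ∂volume) * (2 * volume (sparseCore S Q)) := by
    rw [setLAverage_eq]
    calc ∫⁻ y in (Q : Set (Fin n → ℝ)), g y
        = (∫⁻ y in (Q : Set (Fin n → ℝ)), g y) / volume (Q : Set (Fin n → ℝ)) *
          volume (Q : Set (Fin n → ℝ)) :=
          (ENNReal.div_mul_cancel hQ.volume_ne_zero hQ.volume_ne_top).symm
      _ ≤ _ := by
          gcongr
          exact volume_le_two_mul_sparseCore hS hsp Q.2
  refine (mul_le_mul_right hgQ _).trans (le_of_eq ?_)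
  ring

/-- Duality reduces the modular estimate for the sparse operator to the estimates for the averages
on the sparse cores, for the exponent `p` and for its conjugate. -/
theorem exists_lintegral_lsparseOp_div_rpow_le_one (hsp : IsSparse S)
    {ε η : Set (Fin n → ℝ) → ℝ} (hη : ∀ Q ∈ S, 0 ≤ η Q) (hηε : ∀ Q ∈ S, η Q * η Q = ε Q)
    {p : (Fin n → ℝ) → ℝ} (hp : Measurable p) (hp1 : ∀ x, 1 ≤ p x) (hp1' : ∀ᵐ x, 1 < p x)
    {b : ℝ} (hpb : ∀ᵐ x, p x ≤ b) {K₁ K₂ : ℝ≥0∞} (hK₁ : K₁ ≠ ∞) (hK₂ : K₂ ≠ ∞)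
    (h₁ : ∀ h : (Fin n → ℝ) → ℝ≥0∞, Measurable h → (∀ x, h x ≠ ∞) → ∫⁻ x, h x ^ p x ≤ 1 →
      ∑' Q : S, ∫⁻ x in sparseCore S Q,
        (ENNReal.ofReal (η Q) * ⨍⁻ y in (Q : Set (Fin n → ℝ)), h y ∂volume) ^ p x ≤ K₁)
    (h₂ : ∀ h : (Fin n → ℝ) → ℝ≥0∞, Measurable h → (∀ x, h x ≠ ∞) →
      ∫⁻ x, h x ^ (p x).conjExponent ≤ 1 →
      ∑' Q : S, ∫⁻ x in sparseCore S Q,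
        (ENNReal.ofReal (η Q) * ⨍⁻ y in (Q : Set (Fin n → ℝ)), h y ∂volume) ^
          (p x).conjExponent ≤ K₂) :
    ∃ Λ : ℝ, 0 < Λ ∧ ∀ f : (Fin n → ℝ) → ℝ≥0∞, Measurable f → (∀ x, f x ≠ ∞) →
      ∫⁻ x, f x ^ p x ≤ 1 →
      ∫⁻ x, (lsparseOp ε S f x / ENNReal.ofReal Λ) ^ p x ≤ 1 := by
  have hKtop : 2 * (K₁ + K₂) ≠ ∞ := by finiteness
  refine ⟨(2 * (K₁ + K₂)).toReal + 1, by positivity, fun f hf hftop hint => ?_⟩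
  set Λ := ENNReal.ofReal ((2 * (K₁ + K₂)).toReal + 1) with hΛ
  have hΛ0 : Λ ≠ 0 := (ENNReal.ofReal_pos.2 (by positivity)).ne'
  have hΛtop : Λ ≠ ∞ := ENNReal.ofReal_ne_top
  have hKΛ : 2 * (K₁ + K₂) < Λ := (ENNReal.lt_ofReal_iff_toReal_lt hKtop).2 (lt_add_one _)
  set F := lsparseOp ε S f with hF
  have hFm : Measurable F := measurable_lsparseOp hS ε f
  set FN : ℕ → (Fin n → ℝ) → ℝ≥0∞ := fun N =>
    (Metric.closedBall 0 N).indicator fun x => min (F x) N with hFN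
  have hFNm : ∀ N, Measurable (FN N) := fun N =>
    (hFm.min measurable_const).indicator Metric.isClosed_closedBall.measurableSet
  have hFNF : ∀ N x, FN N x ≤ F x := by
    intro N x
    by_cases hx : x ∈ Metric.closedBall (0 : Fin n → ℝ) N
    · rw [hFN]; simp only [indicator_of_mem hx]; exact min_le_left _ _
    · rw [hFN]; simp only [indicator_of_notMem hx]; exact zero_le
  have hFNN : ∀ N x, FN N x ≤ N := by
    intro N x
    by_cases hx : x ∈ Metric.closedBall (0 : Fin n → ℝ) N
    · rw [hFN]; simp only [indicator_of_mem hx]; exact min_le_right _ _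
    · rw [hFN]; simp only [indicator_of_notMem hx]; exact zero_le
  have hbound : ∀ N, ∫⁻ x, (FN N x / Λ) ^ p x ≤ 1 := by
    intro N
    by_contra! hA
    set G : (Fin n → ℝ) → ℝ≥0∞ := fun x => FN N x / Λ with hG
    have hGm : Measurable G := (hFNm N).div_const _
    have hGtop : ∀ x, G x ≠ ∞ := fun x =>
      ENNReal.div_ne_top (ne_top_of_le_ne_top (by simp) (hFNN N x)) hΛ0
    set A := ∫⁻ x, G x ^ p x with hAdef
    have hA0 : A ≠ 0 := (zero_lt_one.trans hA).ne'
    have hAtop : A ≠ ∞ := by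
      set c : ℝ≥0∞ := max 1 (N / Λ) with hc
      have hctop : c ≠ ∞ := by
        have : (N : ℝ≥0∞) / Λ ≠ ∞ := ENNReal.div_ne_top (by simp) hΛ0
        simp [hc, this]
      have hle : A ≤ ∫⁻ x, (Metric.closedBall (0 : Fin n → ℝ) N).indicator (fun _ => c ^ b) x := by
        refine lintegral_mono_ae ?_
        filter_upwards [hpb] with x hx
        have hpx : 0 < p x := zero_lt_one.trans_le (hp1 x)
        by_cases hxN : x ∈ Metric.closedBall (0 : Fin n → ℝ) N
        · rw [indicator_of_mem hxN]
          calc G x ^ p x ≤ c ^ p x := ENNReal.rpow_le_rpow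
                ((ENNReal.div_le_div_right (hFNN N x) _).trans (le_max_right _ _)) hpx.le
            _ ≤ c ^ b := ENNReal.rpow_le_rpow_of_exponent_le (le_max_left _ _) hx
        · have : G x = 0 := by simp only [hG, hFN, indicator_of_notMem hxN, ENNReal.zero_div]
          rw [this, ENNReal.zero_rpow_of_pos hpx]
          exact zero_le
      refine ne_top_of_le_ne_top ?_ hle
      rw [lintegral_indicator Metric.isClosed_closedBall.measurableSet, setLIntegral_const]
      refine ENNReal.mul_ne_top ?_ measure_closedBall_lt_top.ne
      have hb : 0 ≤ b := by
        obtain ⟨x, hx⟩ := hpb.exists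
        linarith [hp1 x]
      exact ENNReal.rpow_ne_top_of_nonneg hb hctop
    set g : (Fin n → ℝ) → ℝ≥0∞ := fun x => G x ^ (p x - 1) / A with hg
    have hgm : Measurable g := (hGm.pow (hp.sub_const 1)).div_const _
    have hgtop : ∀ x, g x ≠ ∞ := fun x => ENNReal.div_ne_top
      (ENNReal.rpow_ne_top_of_nonneg (by linarith [hp1 x]) (hGtop x)) hA0
    have hgint : ∫⁻ x, g x ^ (p x).conjExponent ≤ 1 := by
      calc ∫⁻ x, g x ^ (p x).conjExponent ≤ ∫⁻ x, G x ^ p x * A⁻¹ := by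
            refine lintegral_mono_ae ?_
            filter_upwards [hp1'] with x hx
            have hconj := Real.HolderConjugate.conjExponent hx
            have hmul : (p x - 1) * (p x).conjExponent = p x := hconj.sub_one_mul_conj
            rw [hg]
            simp only [div_eq_mul_inv]
            rw [ENNReal.mul_rpow_of_nonneg _ _ hconj.symm.nonneg, ← ENNReal.rpow_mul, hmul]
            gcongr
            simpa using ENNReal.rpow_le_rpow_of_exponent_ge
              (ENNReal.inv_le_one.2 hA.le) hconj.symm.lt.le
        _ = A * A⁻¹ := lintegral_mul_const _ (hGm.pow hp)
        _ = 1 := ENNReal.mul_inv_cancel hA0 hAtop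
    have hlower : Λ ≤ ∫⁻ x, F x * g x := by
      calc Λ = Λ * (A * A⁻¹) := by rw [ENNReal.mul_inv_cancel hA0 hAtop, mul_one]
        _ = ∫⁻ x, Λ * (G x ^ p x * A⁻¹) := by
            rw [lintegral_const_mul _ ((hGm.pow hp).mul_const _),
              lintegral_mul_const _ (hGm.pow hp)]
        _ ≤ ∫⁻ x, F x * g x := by
            refine lintegral_mono fun x => ?_
            have h3 : G x ^ p x = G x * G x ^ (p x - 1) := by
              conv_lhs => rw [show p x = 1 + (p x - 1) by ring]
              rw [ENNReal.rpow_add_of_nonneg _ _ zero_le_one (by linarith [hp1 x]),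
                ENNReal.rpow_one]
            have h4 : Λ * G x = FN N x := ENNReal.mul_div_cancel hΛ0 hΛtop
            rw [h3, ← mul_assoc, ← mul_assoc, h4, mul_assoc]
            exact mul_le_mul_left (hFNF N x) _
    have hupper : ∫⁻ x, F x * g x ≤ 2 * (K₁ + K₂) := by
      refine (lintegral_lsparseOp_mul_le hS hsp hη hηε f hgm).trans ?_
      gcongr
      refine le_trans ?_ (add_le_add (h₁ f hf hftop hint) (h₂ g hgm hgtop hgint))
      rw [← ENNReal.tsum_add]
      refine ENNReal.tsum_le_tsum fun Q => ?_
      rw [← lintegral_add_left (by fun_prop), ← setLIntegral_const]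
      refine lintegral_mono_ae (ae_restrict_of_ae ?_)
      filter_upwards [hp1'] with x hx
      have hconj := Real.HolderConjugate.conjExponent hx
      refine (ENNReal.young_inequality _ _ hconj).trans (add_le_add ?_ ?_)
      · exact ENNReal.div_le_of_le_mul
          (le_mul_of_one_le_right zero_le (ENNReal.one_le_ofReal.2 hx.le))
      · exact ENNReal.div_le_of_le_mul
          (le_mul_of_one_le_right zero_le (ENNReal.one_le_ofReal.2 hconj.symm.lt.le))
    exact absurd (hlower.trans hupper) (not_le.2 hKΛ)
  have hlim : ∀ x, Filter.Tendsto (fun N => (FN N x / Λ) ^ p x) Filter.atTop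
      (nhds ((F x / Λ) ^ p x)) := by
    intro x
    refine (ENNReal.continuous_rpow_const.tendsto _).comp (ENNReal.Tendsto.div_const ?_
      (Or.inr hΛ0))
    have h3 : Filter.Tendsto (fun N : ℕ => min (F x) (N : ℝ≥0∞)) Filter.atTop (nhds (F x)) := by
      simpa using tendsto_const_nhds.min ENNReal.tendsto_nat_nhds_top
    refine h3.congr' ?_
    obtain ⟨N₀, hN₀⟩ := exists_nat_ge ‖x‖
    filter_upwards [Filter.eventually_ge_atTop N₀] with N hN
    have hx : x ∈ Metric.closedBall (0 : Fin n → ℝ) N := by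
      rw [mem_closedBall_zero_iff]
      exact hN₀.trans (by exact_mod_cast hN)
    simp only [hFN, indicator_of_mem hx]
  calc ∫⁻ x, (F x / Λ) ^ p x
      = ∫⁻ x, Filter.liminf (fun N => (FN N x / Λ) ^ p x) Filter.atTop :=
        lintegral_congr fun x => (hlim x).liminf_eq.symm
    _ ≤ Filter.liminf (fun N => ∫⁻ x, (FN N x / Λ) ^ p x) Filter.atTop :=
        lintegral_liminf_le fun N => ((hFNm N).div_const _).pow hp
    _ ≤ 1 := Filter.liminf_le_of_frequently_le' (Filter.Frequently.of_forall hbound)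

end Sparse

theorem Real.conjExponent_sub_conjExponent {x y : ℝ} (hx : 1 < x) (hy : 1 < y) :
    x.conjExponent - y.conjExponent = (y - x) / ((x - 1) * (y - 1)) := by
  have hx' : x - 1 ≠ 0 := by linarith
  have hy' : y - 1 ≠ 0 := by linarith
  simp only [Real.conjExponent]
  field_simp
  ring

theorem Real.conjExponent_le_conjExponent {x y : ℝ} (hx : 1 < x) (hxy : x ≤ y) :
    y.conjExponent ≤ x.conjExponent := by
  have h := Real.conjExponent_sub_conjExponent hx (hx.trans_le hxy)
  have : 0 ≤ (y - x) / ((x - 1) * (y - 1)) :=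
    div_nonneg (by linarith) (mul_nonneg (by linarith) (by linarith))
  linarith

theorem Real.abs_conjExponent_sub_le {s x y : ℝ} (hs : 1 < s) (hx : s ≤ x) (hy : s ≤ y) :
    |x.conjExponent - y.conjExponent| ≤ |x - y| / (s - 1) ^ 2 := by
  rw [Real.conjExponent_sub_conjExponent (hs.trans_le hx) (hs.trans_le hy), abs_div,
    abs_sub_comm y x, abs_of_pos (mul_pos (sub_pos.2 (hs.trans_le hx))
      (sub_pos.2 (hs.trans_le hy)))]
  have : 0 < s - 1 := sub_pos.2 hs
  refine div_le_div_of_nonneg_left (abs_nonneg _) (by positivity) ?_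
  rw [sq]
  exact mul_le_mul (by linarith) (by linarith) this.le (by linarith)

theorem Real.rpow_conjExponent_sub_le {a s u v C : ℝ} (ha : 0 < a) (hs : 1 < s) (hu : s ≤ u)
    (huv : u ≤ v) (h : a ^ (u - v) ≤ C) :
    a ^ (v.conjExponent - u.conjExponent) ≤ max 1 C ^ (1 / (s - 1) ^ 2) := by
  have hs' : 0 < (s - 1) ^ 2 := by have := sub_pos.2 hs; positivity
  have hle := Real.conjExponent_le_conjExponent (hs.trans_le hu) huv
  have hdist := Real.abs_conjExponent_sub_le hs (hu.trans huv) hu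
  rw [abs_of_nonpos (by linarith), abs_of_nonneg (by linarith)] at hdist
  rcases le_total 1 a with h1 | h1
  · exact (Real.rpow_le_one_of_one_le_of_nonpos h1 (by linarith)).trans
      (Real.one_le_rpow (le_max_left _ _) (by positivity))
  calc a ^ (v.conjExponent - u.conjExponent) ≤ a ^ ((u - v) * (1 / (s - 1) ^ 2)) := by
        refine Real.rpow_le_rpow_of_exponent_ge ha h1 ?_
        rw [mul_one_div, ← neg_sub v u, neg_div]
        linarith
    _ = (a ^ (u - v)) ^ (1 / (s - 1) ^ 2) := Real.rpow_mul ha.le _ _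
    _ ≤ _ := Real.rpow_le_rpow (by positivity) (h.trans (le_max_right _ _)) (by positivity)

theorem abs_sub_max_min_le {s b x c : ℝ} (hs : s ≤ x) (hb : x ≤ b) :
    |x - max s (min c b)| ≤ |x - c| := by
  rcases max_cases s (min c b) with h | h <;> rcases min_cases c b with h' | h' <;>
    rcases abs_cases (x - c) with h'' | h'' <;> rw [abs_le] <;> constructor <;> linarith

theorem le_essInf_and_essSup_le {α : Type*} {m : MeasurableSpace α} {μ : Measure α} (hμ : μ ≠ 0)
    {p : α → ℝ} {s b : ℝ} (hs : ∀ᵐ x ∂μ, s ≤ p x) (hb : ∀ᵐ x ∂μ, p x ≤ b) :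
    (s ≤ essInf p μ ∧ essSup p μ ≤ b) ∧
      ∀ᵐ x ∂μ, essInf p μ ≤ p x ∧ p x ≤ essSup p μ := by
  have : NeZero μ := ⟨hμ⟩
  have hbdd : Filter.IsBoundedUnder (· ≤ ·) (ae μ) p :=
    Filter.isBoundedUnder_of_eventually_le hb
  have hbdd' : Filter.IsBoundedUnder (· ≥ ·) (ae μ) p :=
    Filter.isBoundedUnder_of_eventually_ge hs
  exact ⟨⟨le_essInf_of_ae_le s hs hbdd.isCoboundedUnder_ge,
    essSup_le_of_ae_le b hb hbdd'.isCoboundedUnder_le⟩,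
    (ae_essInf_le hbdd').and (ae_le_essSup hbdd)⟩

/-- A modular estimate for the `ε`-sparse operator yields the norm estimate. -/
theorem varLpNorm_sparseOp_le {α : Type*} [MeasureSpace α] {ε : Set α → ℝ} {S : Set (Set α)}
    (hε : ∀ Q ∈ S, 0 ≤ ε Q) (hS : ∀ Q ∈ S, volume Q ≠ 0) (hS' : ∀ Q ∈ S, volume Q ≠ ∞)
    {p : α → ℝ} (hp : ∀ x, 0 ≤ p x) {Λ : ℝ} (hΛ : 0 < Λ)
    (hmod : ∀ f : α → ℝ≥0∞, Measurable f → (∀ x, f x ≠ ∞) → ∫⁻ x, f x ^ p x ≤ 1 →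
      ∫⁻ x, (lsparseOp ε S f x / ENNReal.ofReal Λ) ^ p x ≤ 1)
    {f : α → ℝ} (hf : Measurable f) (hf0 : ∀ x, 0 ≤ f x) :
    varLpNorm p volume (sparseOp ε S f) ≤ ENNReal.ofReal Λ * varLpNorm p volume f := by
  have hΛ0 : ENNReal.ofReal Λ ≠ 0 := (ENNReal.ofReal_pos.2 hΛ).ne'
  rw [← ENNReal.div_le_iff' hΛ0 ENNReal.ofReal_ne_top]
  refine le_sInf ?_
  rintro _ ⟨r, hr, rfl, hint⟩
  rw [ENNReal.div_le_iff' hΛ0 ENNReal.ofReal_ne_top]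
  refine sInf_le ⟨Λ * r, by positivity, (ENNReal.ofReal_mul hΛ.le).symm, ?_⟩
  have hr0 : ENNReal.ofReal r ≠ 0 := (ENNReal.ofReal_pos.2 hr).ne'
  have hg : Measurable fun x => ENNReal.ofReal (f x / r) := (hf.div_const r).ennreal_ofReal
  have hfg : (fun x => ENNReal.ofReal (f x)) =
      fun x => ENNReal.ofReal r * ENNReal.ofReal (f x / r) := by
    funext x
    rw [← ENNReal.ofReal_mul hr.le, mul_div_cancel₀ _ hr.ne']
  refine le_trans (lintegral_mono fun x => ?_)
    (hmod (fun x => ENNReal.ofReal (f x / r)) hg (fun _ => ENNReal.ofReal_ne_top) ?_)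
  · have hnn : 0 ≤ sparseOp ε S f x := tsum_nonneg fun Q => indicator_nonneg (fun _ _ =>
      mul_nonneg (hε Q Q.2) (mul_nonneg (by positivity) (integral_nonneg hf0))) x
    have hle := ofReal_sparseOp_le hε hS hS' hf hf0 x
    rw [hfg, lsparseOp_const_mul _ _ hg] at hle
    rw [← ENNReal.ofReal_rpow_of_nonneg (by positivity) (hp x), abs_of_nonneg hnn]
    refine ENNReal.rpow_le_rpow ?_ (hp x)
    rw [ENNReal.ofReal_div_of_pos (by positivity), ENNReal.ofReal_mul hΛ.le]
    refine ENNReal.div_le_of_le_mul (hle.trans (le_of_eq ?_))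
    rw [← mul_assoc, ENNReal.div_mul_cancel hΛ0 ENNReal.ofReal_ne_top, mul_comm]
  · refine le_trans (le_of_eq (lintegral_congr fun x => ?_)) hint
    rw [abs_of_nonneg (hf0 x), ENNReal.ofReal_rpow_of_nonneg (div_nonneg (hf0 x) hr.le) (hp x)]

/-- **Inequality (4.1): boundedness of the ε-sparse operator.**
Let `ε = {ε_Q}` be a bounded collection of positive numbers with the domination
property, `𝒮 ⊆ 𝒟` a sparse collection with associated ε-sparse operator `S_ε`.
If `p ∈ √εLH_0(ℝⁿ) ∩ LH_∞(ℝⁿ)` with `1 < p_- ≤ p_+ < ∞`, then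
`‖S_ε f‖_{p(·)} ≲ ‖f‖_{p(·)}` for every nonnegative `f ∈ L^{p(·)}(ℝⁿ)`. -/
theorem sparseOp_bounded (n : ℕ) (ε : Set (Fin n → ℝ) → ℝ)
    (hεpos : ∀ Q, IsDyadicCube n Q → 0 < ε Q)
    (hεbdd : ∃ B : ℝ, ∀ Q, IsDyadicCube n Q → ε Q ≤ B)
    (hεdom : ∀ P Q, IsDyadicCube n P → IsDyadicCube n Q → P ⊆ Q → ε P ≤ ε Q)
    (S : Set (Set (Fin n → ℝ))) (hSdyadic : ∀ Q ∈ S, IsDyadicCube n Q)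
    (hSsparse : IsSparse S)
    (p : (Fin n → ℝ) → ℝ) (hpMeas : Measurable p) (hp1 : ∀ x, 1 ≤ p x)
    (hpminus : 1 < essInf p volume)
    (hpplus : ∃ B : ℝ, ∀ᵐ x ∂volume, p x ≤ B)
    (hLH0 : ∃ C0 : ℝ, 0 < C0 ∧ ∀ Q, IsDyadicCube n Q →
      ((volume Q).toReal / Real.sqrt (ε Q)) ^
        (essInf p (volume.restrict Q) - essSup p (volume.restrict Q)) ≤ C0)
    (hLHinf : ∃ Cinf : ℝ, 0 < Cinf ∧ ∃ pinf : ℝ, ∀ x : Fin n → ℝ,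
      |p x - pinf| ≤ Cinf / Real.log (Real.exp 1 + ‖x‖)) :
    ∃ C : ℝ, 0 < C ∧ ∀ f : (Fin n → ℝ) → ℝ, Measurable f → (∀ x, 0 ≤ f x) →
      MemVarLp p volume f →
      varLpNorm p volume (sparseOp ε S f) ≤ ENNReal.ofReal C * varLpNorm p volume f := by
  obtain ⟨B, hB⟩ := hεbdd
  obtain ⟨b, hpb⟩ := hpplus
  obtain ⟨C₀, -, hloc⟩ := hLH0
  obtain ⟨Cinf, -, pinf, hinf⟩ := hLHinf
  set s := essInf p volume
  have hsp : ∀ᵐ x, s ≤ p x :=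
    ae_essInf_le (Filter.isBoundedUnder_of_eventually_ge (.of_forall hp1))
  have hsb : s ≤ b := by
    obtain ⟨x, hx, hx'⟩ := (hsp.and hpb).exists
    exact hx.trans hx'
  have hb1 : 1 < b := hpminus.trans_le hsb
  have hη : ∀ Q ∈ S, 0 < √(ε Q) := fun Q hQ => Real.sqrt_pos.2 (hεpos Q (hSdyadic Q hQ))
  have hηB : ∀ Q ∈ S, √(ε Q) ≤ max 1 √B := fun Q hQ =>
    (Real.sqrt_le_sqrt (hB Q (hSdyadic Q hQ))).trans (le_max_right _ _)
  have hrange : ∀ Q ∈ S, (s ≤ essInf p (volume.restrict Q) ∧ essSup p (volume.restrict Q) ≤ b) ∧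
      ∀ᵐ x ∂volume.restrict Q,
        essInf p (volume.restrict Q) ≤ p x ∧ p x ≤ essSup p (volume.restrict Q) :=
    fun Q hQ => le_essInf_and_essSup_le
      (by simpa using (hSdyadic Q hQ).volume_ne_zero)
      (ae_restrict_of_ae hsp) (ae_restrict_of_ae hpb)
  set c := max s (min pinf b)
  have hsc : s ≤ c := le_max_left _ _
  have hc : ∀ᵐ x, |p x - c| ≤ Cinf / Real.log (Real.exp 1 + ‖x‖) := by
    filter_upwards [hsp, hpb] with x hx hx'
    exact (abs_sub_max_min_le hx hx').trans (hinf x)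
  obtain ⟨K₁, hK₁, h₁⟩ := exists_tsum_setLIntegral_laverage_rpow_le hSdyadic hη hηB
    (le_max_left _ _) hpMeas (fun x => zero_le_one.trans (hp1 x)) hpminus hsp hpb
    (fun Q hQ => ⟨_, _, (hrange Q hQ).1.1, (hrange Q hQ).2, hloc Q (hSdyadic Q hQ)⟩) hsc hc
  have hcb : c ≤ b := max_le hsb (min_le_right _ _)
  obtain ⟨K₂, hK₂, h₂⟩ := exists_tsum_setLIntegral_laverage_rpow_le
    (q := fun x => (p x).conjExponent) (s := b.conjExponent) (b := s.conjExponent)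
    (C₀ := max 1 C₀ ^ (1 / (s - 1) ^ 2)) (Cinf := Cinf / (s - 1) ^ 2)
    (qinf := c.conjExponent) hSdyadic hη hηB (le_max_left _ _)
    (hpMeas.div (hpMeas.sub_const 1))
    (fun x => div_nonneg (by linarith [hp1 x]) (by linarith [hp1 x]))
    (Real.HolderConjugate.conjExponent hb1).symm.lt
    (by
      filter_upwards [hsp, hpb] with x hx hx'
      exact Real.conjExponent_le_conjExponent (hpminus.trans_le hx) hx')
    (by
      filter_upwards [hsp] with x hx
      exact Real.conjExponent_le_conjExponent hpminus hx)
    (fun Q hQ => by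
      have hQd := hSdyadic Q hQ
      obtain ⟨⟨hs, hb⟩, hae⟩ := hrange Q hQ
      have : NeZero (volume.restrict Q) := ⟨by simpa using hQd.volume_ne_zero⟩
      obtain ⟨y, hy, hy'⟩ := hae.exists
      refine ⟨(essSup p (volume.restrict Q)).conjExponent,
        (essInf p (volume.restrict Q)).conjExponent,
        Real.conjExponent_le_conjExponent (hpminus.trans_le (hs.trans (hy.trans hy'))) hb, ?_,
        Real.rpow_conjExponent_sub_le (div_pos (ENNReal.toReal_pos hQd.volume_ne_zero
          hQd.volume_ne_top) (hη Q hQ)) hpminus hs (hy.trans hy') (hloc Q hQd)⟩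
      filter_upwards [hae] with x hx
      exact ⟨Real.conjExponent_le_conjExponent (hpminus.trans_le (hs.trans hx.1)) hx.2,
        Real.conjExponent_le_conjExponent (hpminus.trans_le hs) hx.1⟩)
    (Real.conjExponent_le_conjExponent (hpminus.trans_le hsc) hcb)
    (by
      filter_upwards [hsp, hc] with x hx hx'
      refine (Real.abs_conjExponent_sub_le hpminus hx hsc).trans ?_
      rw [div_right_comm]
      gcongr)
  obtain ⟨Λ, hΛ, hmod⟩ := exists_lintegral_lsparseOp_div_rpow_le_one hSdyadic hSsparse
    (fun Q hQ => (hη Q hQ).le)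
    (fun Q hQ => Real.mul_self_sqrt (hεpos Q (hSdyadic Q hQ)).le) hpMeas hp1
    (hsp.mono fun x hx => hpminus.trans_le hx) hpb hK₁ hK₂ h₁ h₂
  exact ⟨Λ, hΛ, fun f hf hf0 _ => varLpNorm_sparseOp_le
    (fun Q hQ => (hεpos Q (hSdyadic Q hQ)).le) (fun Q hQ => (hSdyadic Q hQ).volume_ne_zero)
    (fun Q hQ => (hSdyadic Q hQ).volume_ne_top) (fun x => zero_le_one.trans (hp1 x)) hΛ hmod
    hf hf0⟩
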